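/- For every positive integer h, the series Σ_{q=1}^∞ (μ²(q)/φ²(q)) c_q(h) converges absolutely. -/

import Mathlib

open Finset Filter ArithmeticFunction

/-- The Ramanujan sum `c_q(n) = ∑_{k=1, gcd(k,q)=1}^{q} e^{2πi k n / q}`. -/
noncomputable def ramanujanSum (q n : ℕ) : ℂ :=
  ∑ k ∈ (Finset.Icc 1 q).filter (fun k => Nat.gcd k q = 1),
    Complex.exp (2 * Real.pi * Complex.I * k * n / q)

theorem ramanujanSum_eq_sum_primitiveRoots {q : ℕ} (hq : 0 < q) (n : ℕ) :
    ramanujanSum q n = ∑ ζ ∈ primitiveRoots q ℂ, ζ ^ n := by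
  have hq' : (q : ℂ) ≠ 0 := by exact_mod_cast hq.ne'
  have hinj : Set.InjOn (fun k : ℕ => Complex.exp (2 * Real.pi * Complex.I * (k / q)))
      ((Finset.Icc 1 q).filter (fun k => Nat.gcd k q = 1)) := by
    intro a ha b hb hab
    have h0 := Complex.isPrimitiveRoot_exp q hq.ne'
    have hpow (k : ℕ) : Complex.exp (2 * Real.pi * Complex.I * (k / q)) =
        Complex.exp (2 * Real.pi * Complex.I / q) ^ k := by
      rw [← Complex.exp_nat_mul]; congr 1; ring
    simp only [hpow] at hab
    rw [Finset.mem_coe, Finset.mem_filter, Finset.mem_Icc] at ha hb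
    obtain ⟨a, rfl⟩ := Nat.exists_eq_add_of_le' ha.1.1
    obtain ⟨b, rfl⟩ := Nat.exists_eq_add_of_le' hb.1.1
    rw [pow_succ, pow_succ] at hab
    rw [h0.pow_inj ha.1.2 hb.1.2 (mul_right_cancel₀ (h0.ne_zero hq.ne') hab)]
  have himage : ((Finset.Icc 1 q).filter (fun k => Nat.gcd k q = 1)).image
      (fun k : ℕ => Complex.exp (2 * Real.pi * Complex.I * (k / q))) = primitiveRoots q ℂ := by
    refine Finset.eq_of_subset_of_card_le ?_ ?_
    · simp only [Finset.image_subset_iff, Finset.mem_filter, mem_primitiveRoots hq]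
      exact fun k hk => Complex.isPrimitiveRoot_exp_of_coprime k q hq.ne' hk.2
    · rw [Finset.card_image_of_injOn hinj, Complex.card_primitiveRoots,
        ← Nat.filter_coprime_Ico_eq_totient q 1, add_comm 1 q, Finset.Ico_add_one_right_eq_Icc]
      simp only [Nat.coprime_comm (n := q), Nat.Coprime, le_refl]
  rw [← himage, Finset.sum_image hinj, ramanujanSum]
  refine Finset.sum_congr rfl fun k _ => ?_
  rw [← Complex.exp_nat_mul]
  congr 1
  ring

theorem sum_divisors_ramanujanSum {q : ℕ} (hq : 0 < q) (n : ℕ) :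
    ∑ d ∈ q.divisors, ramanujanSum d n = if q ∣ n then (q : ℂ) else 0 := by
  have hζ := Complex.isPrimitiveRoot_exp q hq.ne'
  have hroots : ∑ d ∈ q.divisors, ramanujanSum d n =
      ∑ ζ ∈ Polynomial.nthRootsFinset q (1 : ℂ), ζ ^ n := by
    rw [IsPrimitiveRoot.nthRoots_one_eq_biUnion_primitiveRoots, Finset.sum_biUnion]
    · exact Finset.sum_congr rfl fun d hd =>
        ramanujanSum_eq_sum_primitiveRoots (Nat.pos_of_mem_divisors hd) n
    · exact fun _ _ _ _ hab => IsPrimitiveRoot.disjoint hab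
  rw [hroots]
  split_ifs with hdvd
  · obtain ⟨m, rfl⟩ := hdvd
    rw [Finset.sum_congr rfl (g := fun _ => 1), Finset.sum_const, hζ.card_nthRootsFinset]
    · simp
    · intro z hz
      rw [pow_mul, (Polynomial.mem_nthRootsFinset hq 1).1 hz, one_pow]
  · set ζ := Complex.exp (2 * Real.pi * Complex.I / q)
    have hmul : ∑ z ∈ Polynomial.nthRootsFinset q (1 : ℂ), z ^ n =
        ∑ z ∈ Polynomial.nthRootsFinset q (1 : ℂ), (ζ * z) ^ n := by
      refine (Finset.sum_bij (fun z _ => ζ * z) ?_ ?_ ?_ fun _ _ => rfl).symm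
      · intro z hz
        rw [Polynomial.mem_nthRootsFinset hq] at hz ⊢
        rw [mul_pow, hz, hζ.pow_eq_one, one_mul]
      · intro a _ b _ hab
        exact mul_left_cancel₀ (hζ.ne_zero hq.ne') hab
      · intro z hz
        refine ⟨ζ⁻¹ * z, ?_, mul_inv_cancel_left₀ (hζ.ne_zero hq.ne') z⟩
        rw [Polynomial.mem_nthRootsFinset hq] at hz ⊢
        rw [mul_pow, hz, inv_pow, hζ.pow_eq_one, inv_one, one_mul]
    simp only [mul_pow, ← Finset.mul_sum] at hmul
    have hne : ζ ^ n ≠ 1 := fun h => hdvd ((hζ.pow_eq_one_iff_dvd n).1 h)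
    by_contra h0
    exact hne (mul_right_cancel₀ h0 (by rw [one_mul]; exact hmul.symm))

theorem norm_ramanujanSum_le {q n : ℕ} (hq : 0 < q) (hn : 0 < n) :
    ‖ramanujanSum q n‖ ≤ ∑ d ∈ n.divisors, (d : ℝ) := by
  have hinv := sum_eq_iff_sum_mul_moebius_eq.1
    (fun q hq => sum_divisors_ramanujanSum (q := q) hq n) q hq
  rw [← hinv, Nat.sum_divisorsAntidiagonal' fun a b : ℕ =>
    ((moebius a : ℤ) : ℂ) * if b ∣ n then (b : ℂ) else 0]
  calc _ ≤ ∑ d ∈ q.divisors, if d ∣ n then (d : ℝ) else 0 := by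
        refine norm_sum_le_of_le _ fun d _ => ?_
        split_ifs
        · rw [norm_mul, Complex.norm_natCast, Complex.norm_intCast]
          refine mul_le_of_le_one_left (Nat.cast_nonneg d) ?_
          exact_mod_cast abs_moebius_le_one
        · simp
    _ = ∑ d ∈ q.divisors with d ∣ n, (d : ℝ) := (Finset.sum_filter _ _).symm
    _ ≤ _ := by
        refine Finset.sum_le_sum_of_subset_of_nonneg (fun d hd => ?_) fun _ _ _ => by positivity
        exact Nat.mem_divisors.2 ⟨(Finset.mem_filter.1 hd).2, hn.ne'⟩

theorem Nat.totient_eq_prod_primeFactors_of_squarefree {q : ℕ} (hq : Squarefree q) :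
    q.totient = ∏ p ∈ q.primeFactors, (p - 1) := by
  rw [Nat.totient_eq_div_primeFactors_mul, Nat.prod_primeFactors_of_squarefree hq,
    Nat.div_self hq.ne_zero.bot_lt, one_mul]

theorem summable_moebius_sq_div_totient_sq :
    Summable fun q : ℕ => (moebius q : ℝ) ^ 2 / (q.totient : ℝ) ^ 2 := by
  have hg : Summable fun n : ℕ => (((n - 1 : ℕ) : ℝ) ^ 2)⁻¹ := by
    rw [← summable_nat_add_iff 1]
    simp
  have hprod := summable_finsetProd_of_summable_nonneg (fun n => by positivity) hg
  have hinj : Function.Injective fun q : {q : ℕ // Squarefree q} => (q : ℕ).primeFactors := by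
    intro a b hab
    ext
    rw [← Nat.prod_primeFactors_of_squarefree a.2, ← Nat.prod_primeFactors_of_squarefree b.2]
    exact congrArg (fun s : Finset ℕ => ∏ p ∈ s, p) hab
  refine (summable_subtype_iff_indicator.1 ((hprod.comp_injective hinj).congr fun q => ?_ :
    Summable ((fun q : ℕ => (moebius q : ℝ) ^ 2 / (q.totient : ℝ) ^ 2) ∘
      ((↑) : {q : ℕ | Squarefree q} → ℕ)))).congr fun q => ?_
  · have hsq : ((moebius (q : ℕ) : ℤ) : ℝ) ^ 2 = 1 := by
      exact_mod_cast moebius_sq_eq_one_of_squarefree q.2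
    simp only [Function.comp_apply, hsq, Nat.totient_eq_prod_primeFactors_of_squarefree q.2,
      Nat.cast_prod, one_div, Finset.prod_inv_distrib, Finset.prod_pow]
  · refine Set.indicator_apply_eq_self.2 fun hq => ?_
    simp [moebius_eq_zero_of_not_squarefree hq]

/-- For every positive integer `h`, the series `∑_{q=1}^∞ (μ²(q)/φ²(q)) c_q(h)`
converges absolutely. (The term at `q = 0` vanishes since `μ(0) = 0`.) -/
theorem singularSeries_summable (h : ℕ) (hh : 0 < h) :
    Summable (fun q : ℕ =>
      ‖((moebius q : ℂ) ^ 2 / (Nat.totient q : ℂ) ^ 2) * ramanujanSum q h‖) := by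
  refine (summable_moebius_sq_div_totient_sq.mul_right (∑ d ∈ h.divisors, (d : ℝ))).of_nonneg_of_le
    (fun _ => norm_nonneg _) fun q => ?_
  rcases Nat.eq_zero_or_pos q with rfl | hq
  · simp
  · rw [norm_mul, norm_div, norm_pow, norm_pow, Complex.norm_natCast, Complex.norm_intCast, sq_abs]
    gcongr
    exact norm_ramanujanSum_le hq hh
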